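/- Let (X,π) be a totally connected (d+1)-partite weighted pure d-dimensional complex with parts indexed by [d], and let I_1∪⋯∪I_ℓ be a partition of [d] such that for each 1 ≤ i ≤ ℓ the induced subgraph G_{(X,π)}[I_i] is a connected component or a union of connected components of G_{(X,π)}. Then for any choice of faces σ_{−1},…,σ_{−ℓ}, where σ_{−i} is an arbitrary face of type [d]∖I_i, we have (X,π) = (X_{σ_{−1}},π_{σ_{−1}})×⋯×(X_{σ_{−ℓ}},π_{σ_{−ℓ}}). -/

import Mathlib

open Finset in
/-- A pure `d`-dimensional weighted simplicial complex, given by its facets (all of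
cardinality `d+1`) together with a full-support probability distribution `pi` on the facets.
The faces of the complex are all subsets of facets. -/
structure WeightedComplex (V : Type*) [Fintype V] [DecidableEq V] (d : ℕ) where
  facets : Finset (Finset V)
  facets_nonempty : facets.Nonempty
  pure : ∀ τ ∈ facets, τ.card = d + 1
  pi : Finset V → ℝ
  pi_pos : ∀ τ ∈ facets, 0 < pi τ
  pi_eq_zero : ∀ τ, τ ∉ facets → pi τ = 0
  pi_sum_one : ∑ τ ∈ facets, pi τ = 1

namespace WeightedComplex

variable {V : Type*} [Fintype V] [DecidableEq V] {d : ℕ}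

/-- `σ` is a face of the complex (a subset of some facet). -/
def IsFace (K : WeightedComplex V d) (σ : Finset V) : Prop :=
  ∃ η ∈ K.facets, σ ⊆ η

/-- Total `π`-weight of the facets containing `τ`. -/
noncomputable def faceWeight (K : WeightedComplex V d) (τ : Finset V) : ℝ :=
  ∑ η ∈ K.facets.filter (fun η => τ ⊆ η), K.pi η

/-- `Pr_{σ ∼ π_τ}[{x,y} ⊆ σ]`: the weight of the edge `{x,y}` in the 1-skeleton of the
link of `τ`. -/
noncomputable def linkWeight (K : WeightedComplex V d) (τ : Finset V) (x y : V) : ℝ :=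
  if x = y ∨ x ∈ τ ∨ y ∈ τ then 0
  else (∑ η ∈ K.facets.filter (fun η => τ ⊆ η ∧ x ∈ η ∧ y ∈ η), K.pi η) / K.faceWeight τ

/-- The transition probability matrix `P_τ` of the simple random walk on the 1-skeleton of
the link `(X_τ, π_τ)`, padded with zeros outside the `X_τ(0) × X_τ(0)` block. -/
noncomputable def walkMatrix (K : WeightedComplex V d) (τ : Finset V) : Matrix V V ℝ :=
  Matrix.of fun x y => K.linkWeight τ x y / ∑ z, K.linkWeight τ x z

/-- `Pr_{σ ∼ π_τ}[x ∈ σ]`. -/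
noncomputable def probMem (K : WeightedComplex V d) (τ : Finset V) (x : V) : ℝ :=
  if x ∈ τ then 0 else K.faceWeight (insert x τ) / K.faceWeight τ

/-- The vertex marginal `π_{τ,0}(x) = Pr_{σ∼π_τ}[x ∈ σ] / codim(τ)`, viewed as a vector on all
of `V` (zero outside `X_τ(0)`). -/
noncomputable def vertexMarginal (K : WeightedComplex V d) (τ : Finset V) (x : V) : ℝ :=
  ((d + 1 - τ.card : ℕ) : ℝ)⁻¹ * K.probMem τ x

/-- The facets of the link `X_τ`. -/
def linkFacets (K : WeightedComplex V d) (τ : Finset V) : Finset (Finset V) :=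
  (K.facets.filter (fun η => τ ⊆ η)).image (fun η => η \ τ)

/-- The facet distribution `π_τ` of the link of `τ`. -/
noncomputable def linkPi (K : WeightedComplex V d) (τ : Finset V) (σ : Finset V) : ℝ :=
  K.pi (σ ∪ τ) / K.faceWeight τ

/-- The 1-skeleton of the link of every face of co-dimension at least 2 is connected. -/
def TotallyConnected (K : WeightedComplex V d) : Prop :=
  ∀ τ : Finset V, K.IsFace τ → τ.card + 2 ≤ d + 1 →
    ∀ x y : V, x ∉ τ → K.IsFace (insert x τ) → y ∉ τ → K.IsFace (insert y τ) →
      Relation.ReflTransGen (fun a b => 0 < K.linkWeight τ a b) x y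

end WeightedComplex

/-- The second largest eigenvalue of a random-walk transition matrix `P`: the largest point of
the real spectrum of `P` lying below the trivial top eigenvalue `1`. -/
noncomputable def lambda2 {n : Type*} [Fintype n] [DecidableEq n] (P : Matrix n n ℝ) : ℝ :=
  sSup {μ : ℝ | μ < 1 ∧ μ ∈ spectrum ℝ P}

/-- A `(d+1)`-partite pure `d`-dimensional weighted complex: each vertex has a type in
`Fin (d+1)` and every facet contains exactly one vertex of each type. -/
structure PartiteWeightedComplex (V : Type*) [Fintype V] [DecidableEq V] (d : ℕ)
    extends WeightedComplex V d where
  vtype : V → Fin (d + 1)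
  partite : ∀ τ ∈ facets, ∀ i : Fin (d + 1), (τ.filter (fun x => vtype x = i)).card = 1

namespace PartiteWeightedComplex

variable {V : Type*} [Fintype V] [DecidableEq V] {d : ℕ}

/-- `ε_{i,j}`: the maximum of `λ₂(P_τ)` over faces `τ` of type `[d] ∖ {i,j}`. -/
noncomputable def eps (K : PartiteWeightedComplex V d) (i j : Fin (d + 1)) : ℝ :=
  sSup {r : ℝ | ∃ τ : Finset V, K.toWeightedComplex.IsFace τ ∧
    τ.image K.vtype = Finset.univ \ {i, j} ∧
    r = lambda2 (K.toWeightedComplex.walkMatrix τ)}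

/-- `Δ(i)`: the number of `j ≠ i` with `ε_{i,j} > 0`. -/
noncomputable def DeltaAt (K : PartiteWeightedComplex V d) (i : Fin (d + 1)) : ℕ :=
  Set.ncard {j : Fin (d + 1) | j ≠ i ∧ 0 < K.eps i j}

/-- `Δ = max_i Δ(i)`. -/
noncomputable def DeltaMax (K : PartiteWeightedComplex V d) : ℕ :=
  Finset.univ.sup fun i => K.DeltaAt i

end PartiteWeightedComplex

namespace RandomWalk

open Matrix

variable {V : Type*} [Fintype V]

theorem eq_zero_of_sum_eq_zero {w : V → V → ℝ} (hw : ∀ x y, 0 ≤ w x y) {x : V}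
    (hx : ∑ z, w x z = 0) (y : V) : w x y = 0 :=
  (Finset.sum_eq_zero_iff_of_nonneg fun z _ => hw x z).1 hx y (Finset.mem_univ y)

variable [DecidableEq V]

/-- The transition matrix of the random walk with edge weights `w`. -/
noncomputable def transition (w : V → V → ℝ) : Matrix V V ℝ :=
  Matrix.of fun x y => w x y / ∑ z, w x z

theorem mem_spectrum_iff_exists_mulVec {A : Matrix V V ℝ} {μ : ℝ} :
    μ ∈ spectrum ℝ A ↔ ∃ v : V → ℝ, v ≠ 0 ∧ A *ᵥ v = μ • v := by
  rw [← Matrix.spectrum_toLin', ← Module.End.hasEigenvalue_iff_mem_spectrum]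
  constructor
  · intro h
    obtain ⟨v, hv⟩ := h.exists_hasEigenvector
    exact ⟨v, hv.2, by simpa using hv.apply_eq_smul⟩
  · rintro ⟨v, hv, h⟩
    exact Module.End.hasEigenvalue_of_hasEigenvector
      (Module.End.hasEigenvector_iff.2 ⟨Module.End.mem_eigenspace_iff.2 (by simpa using h), hv⟩)

theorem spectrum_transition_le_one {w : V → V → ℝ} (hw : ∀ x y, 0 ≤ w x y) {μ : ℝ}
    (hμ : μ ∈ spectrum ℝ (transition w)) : μ ≤ 1 := by
  obtain ⟨v, hv, h⟩ := mem_spectrum_iff_exists_mulVec.1 hμ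
  obtain ⟨z, hz⟩ := Function.ne_iff.1 hv
  obtain ⟨x, -, hx⟩ := Finset.exists_max_image Finset.univ (fun x => |v x|) ⟨z, Finset.mem_univ z⟩
  have hpos : 0 < |v x| := (abs_pos.2 hz).trans_le (hx z (Finset.mem_univ z))
  have hsum : ∑ y, transition w x y ≤ 1 := by
    simp only [transition, Matrix.of_apply, ← Finset.sum_div]
    exact div_self_le_one _
  have hnn : ∀ y, 0 ≤ transition w x y := fun y =>
    div_nonneg (hw x y) (Finset.sum_nonneg fun z _ => hw x z)
  have hmul : μ * |v x| ≤ 1 * |v x| := calc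
    μ * |v x| ≤ |μ * v x| := by
      rw [abs_mul]
      exact mul_le_mul_of_nonneg_right (le_abs_self μ) (abs_nonneg _)
    _ = |∑ y, transition w x y * v y| := by
      have := congrFun h x
      simp only [Matrix.mulVec, dotProduct, Pi.smul_apply, smul_eq_mul] at this
      rw [this]
    _ ≤ ∑ y, transition w x y * |v x| := by
      refine (Finset.abs_sum_le_sum_abs _ _).trans (Finset.sum_le_sum fun y _ => ?_)
      rw [abs_mul, abs_of_nonneg (hnn y)]
      exact mul_le_mul_of_nonneg_left (hx y (Finset.mem_univ y)) (hnn y)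
    _ ≤ 1 * |v x| := by
      rw [← Finset.sum_mul]
      exact mul_le_mul_of_nonneg_right hsum (abs_nonneg _)
  exact le_of_mul_le_mul_right hmul hpos

theorem neg_mem_spectrum_transition {w : V → V → ℝ} {s : V → Prop}
    (hbip : ∀ x y, w x y ≠ 0 → (s x ↔ ¬ s y)) {μ : ℝ}
    (hμ : μ ∈ spectrum ℝ (transition w)) : -μ ∈ spectrum ℝ (transition w) := by
  classical
  obtain ⟨v, hv, h⟩ := mem_spectrum_iff_exists_mulVec.1 hμ
  refine mem_spectrum_iff_exists_mulVec.2 ⟨fun x => if s x then v x else -v x, ?_, ?_⟩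
  · obtain ⟨z, hz⟩ := Function.ne_iff.1 hv
    refine Function.ne_iff.2 ⟨z, ?_⟩
    by_cases hs : s z
    · simpa [hs] using hz
    · simpa [hs] using hz
  · ext x
    have hx := congrFun h x
    simp only [Matrix.mulVec, dotProduct, Pi.smul_apply, smul_eq_mul] at hx ⊢
    have key : ∀ y, transition w x y * (if s y then v y else -v y) =
        (if s x then -1 else 1) * (transition w x y * v y) := by
      intro y
      by_cases hxy : w x y = 0
      · simp [transition, hxy]
      · have := hbip x y hxy
        by_cases h1 : s x <;> by_cases h2 : s y <;> simp_all
    rw [Finset.sum_congr rfl fun y _ => key y, ← Finset.mul_sum, hx]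
    split_ifs <;> ring

/-- A reversible bipartite walk whose eigenvalues below `1` are nonpositive satisfies
`P ^ 3 = P`. -/
theorem transition_pow_three {w : V → V → ℝ} (hw : ∀ x y, 0 ≤ w x y)
    (hsymm : ∀ x y, w x y = w y x) {s : V → Prop}
    (hbip : ∀ x y, w x y ≠ 0 → (s x ↔ ¬ s y))
    (hspec : ∀ μ ∈ spectrum ℝ (transition w), μ < 1 → μ ≤ 0) :
    transition w ^ 3 = transition w := by
  set r : V → ℝ := fun x => √(∑ z, w x z) with hr
  have hr0 : ∀ x, r x = 0 → ∀ y, w x y = 0 := fun x hx =>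
    eq_zero_of_sum_eq_zero hw
      ((Real.sqrt_eq_zero (Finset.sum_nonneg fun z _ => hw x z)).1 hx)
  have hrr : ∀ x, ∑ z, w x z = r x * r x := fun x =>
    (Real.mul_self_sqrt (Finset.sum_nonneg fun z _ => hw x z)).symm
  set M : Matrix V V ℝ := Matrix.of fun x y => w x y / (r x * r y) with hM
  have hMsa : IsSelfAdjoint M := by
    ext x y
    simp [hM, Matrix.star_apply, hsymm y x, mul_comm]
  have hMP : ∀ μ ∈ spectrum ℝ M, μ ≠ 0 → μ ∈ spectrum ℝ (transition w) := by
    intro μ hμ hμ0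
    obtain ⟨v, hv, h⟩ := mem_spectrum_iff_exists_mulVec.1 hμ
    have h' : ∀ x, ∑ y, w x y / (r x * r y) * v y = μ * v x := fun x => by
      simpa [Matrix.mulVec, dotProduct, hM] using congrFun h x
    refine mem_spectrum_iff_exists_mulVec.2 ⟨fun x => v x / r x, ?_, ?_⟩
    · obtain ⟨z, hz⟩ := Function.ne_iff.1 hv
      refine Function.ne_iff.2 ⟨z, div_ne_zero hz fun hrz => ?_⟩
      have := h' z
      simp only [hrz, zero_mul, div_zero, Finset.sum_const_zero] at this
      exact mul_ne_zero hμ0 hz this.symm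
    · ext x
      simp only [Matrix.mulVec, dotProduct, Pi.smul_apply, smul_eq_mul, transition,
        Matrix.of_apply, hrr]
      rw [← mul_div_assoc, ← h' x, Finset.sum_div]
      refine Finset.sum_congr rfl fun y _ => ?_
      simp only [div_eq_mul_inv, mul_inv]
      ring
  have hM3 : M ^ 3 = M := by
    have hE : (spectrum ℝ M).EqOn (fun x : ℝ => x ^ 3) id := by
      intro μ hμ
      by_cases h0 : μ = 0
      · simp [h0]
      · have h1 := hMP μ hμ h0
        have h2 := neg_mem_spectrum_transition hbip h1
        have h3 : μ = 1 ∨ μ = -1 := by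
          rcases lt_or_gt_of_ne h0 with h | h
          · right
            by_contra hne
            have := spectrum_transition_le_one hw h2
            have := hspec _ h2 (lt_of_le_of_ne this fun h => hne (by linarith))
            linarith
          · left
            by_contra hne
            have := hspec _ h1 (lt_of_le_of_ne (spectrum_transition_le_one hw h1) hne)
            linarith
        rcases h3 with rfl | rfl <;> norm_num
    rw [← cfc_pow_id (R := ℝ) M 3 hMsa, cfc_congr hE, cfc_id ℝ M hMsa]
  have hP : transition w = Matrix.diagonal (fun x => (r x)⁻¹) * M * Matrix.diagonal r := by
    ext x y
    simp only [transition, Matrix.of_apply, hrr, Matrix.mul_diagonal, Matrix.diagonal_mul, hM]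
    by_cases hy : r y = 0
    · simp [hsymm x y, hr0 y hy x]
    · by_cases hx : r x = 0
      · simp [hx]
      · field_simp
  have hMD : M * Matrix.diagonal r * Matrix.diagonal (fun x => (r x)⁻¹) = M := by
    ext x y
    simp only [Matrix.mul_diagonal, hM, Matrix.of_apply]
    by_cases hy : r y = 0
    · simp [hy]
    · field_simp
  set D := Matrix.diagonal r
  set E := Matrix.diagonal (fun x => (r x)⁻¹)
  calc transition w ^ 3 = E * ((M * D * E) * (M * D * E) * M) * D := by
        rw [hP]; simp only [pow_succ, pow_zero, one_mul, Matrix.mul_assoc]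
    _ = transition w := by
        rw [hMD, hP]
        rw [← pow_two, ← pow_succ, hM3]

/-- If `P ^ 3 = P`, vertices with a common neighbour have the same rows. -/
theorem transition_row_eq {w : V → V → ℝ} (hw : ∀ x y, 0 ≤ w x y)
    (hsymm : ∀ x y, w x y = w y x) (hcube : transition w ^ 3 = transition w)
    {x x' y : V} (hxy : 0 < w x y) (hxy' : 0 < w x' y) (b : V) :
    transition w x b = transition w x' b := by
  set W : V → ℝ := fun x => ∑ z, w x z with hW
  set f : V → ℝ := fun x => transition w x b with hf
  set k : V → V → ℝ := fun x z => ∑ y, w x y * w y z / W y with hk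
  have hWnn : ∀ x, 0 ≤ W x := fun x => Finset.sum_nonneg fun z _ => hw x z
  have hterm : ∀ x y z, 0 ≤ w x y * w y z / W y := fun x y z =>
    div_nonneg (mul_nonneg (hw x y) (hw y z)) (hWnn y)
  have hknn : ∀ x z, 0 ≤ k x z := fun x z => Finset.sum_nonneg fun y _ => hterm x y z
  have hksymm : ∀ x z, k x z = k z x := fun x z =>
    Finset.sum_congr rfl fun y _ => by rw [hsymm x y, hsymm y z, mul_comm]
  have hksum : ∀ x, ∑ z, k x z = W x := by
    intro x
    simp only [hk]
    rw [Finset.sum_comm]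
    refine Finset.sum_congr rfl fun y _ => ?_
    rw [← Finset.sum_div, ← Finset.mul_sum]
    by_cases hy : W y = 0
    · simp [hy, hsymm x y, eq_zero_of_sum_eq_zero hw hy x]
    · exact mul_div_cancel_right₀ _ hy
  have hkf : ∀ x, ∑ z, k x z * f z = W x * f x := by
    intro x
    have h3 : f x = ∑ y, transition w x y * ∑ z, transition w y z * f z := by
      have h := congrFun (congrFun hcube x) b
      rw [pow_succ', pow_two, Matrix.mul_apply] at h
      simp only [Matrix.mul_apply] at h
      exact h.symm
    rw [h3, Finset.mul_sum]
    simp only [hk, Finset.sum_mul]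
    rw [Finset.sum_comm]
    refine Finset.sum_congr rfl fun y _ => ?_
    rw [Finset.mul_sum, Finset.mul_sum]
    refine Finset.sum_congr rfl fun z _ => ?_
    simp only [transition, Matrix.of_apply]
    by_cases hx : W x = 0
    · simp [eq_zero_of_sum_eq_zero hw hx y]
    · change _ = W x * (w x y / W x * (w y z / W y * f z))
      field_simp
  have henergy : ∑ x, ∑ z, k x z * (f x - f z) ^ 2 = 0 := by
    have h1 : ∀ x z, k x z * (f x - f z) ^ 2 =
        f x ^ 2 * k x z - 2 * f x * (k x z * f z) + f z ^ 2 * k z x := fun x z => by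
      rw [hksymm z x]; ring
    simp only [h1, Finset.sum_add_distrib, Finset.sum_sub_distrib]
    rw [Finset.sum_comm (f := fun x z => f z ^ 2 * k z x)]
    simp only [← Finset.mul_sum, hksum, hkf]
    rw [← Finset.sum_sub_distrib, ← Finset.sum_add_distrib]
    exact Finset.sum_eq_zero fun x _ => by ring
  have hnn : ∀ x z, 0 ≤ k x z * (f x - f z) ^ 2 := fun x z =>
    mul_nonneg (hknn x z) (sq_nonneg _)
  have hzero : k x x' * (f x - f x') ^ 2 = 0 :=
    (Finset.sum_eq_zero_iff_of_nonneg fun z _ => hnn x z).1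
      ((Finset.sum_eq_zero_iff_of_nonneg fun x _ => Finset.sum_nonneg fun z _ => hnn x z).1
        henergy x (Finset.mem_univ x)) x' (Finset.mem_univ x')
  have hkpos : 0 < k x x' := by
    refine Finset.sum_pos' (fun y _ => hterm x y x') ⟨y, Finset.mem_univ y, ?_⟩
    have hyx : 0 < w y x' := hsymm x' y ▸ hxy'
    exact div_pos (mul_pos hxy hyx)
      (Finset.sum_pos' (fun z _ => hw y z) ⟨x', Finset.mem_univ x', hyx⟩)
  exact sub_eq_zero.1 (pow_eq_zero_iff two_ne_zero |>.1
    ((mul_eq_zero.1 hzero).resolve_left hkpos.ne'))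

/-- The weights of a bipartite walk without eigenvalues in `(0, 1)` have vanishing `2 × 2` minors
on neighbourhoods. -/
theorem weight_mul_weight_comm {w : V → V → ℝ} (hw : ∀ x y, 0 ≤ w x y)
    (hsymm : ∀ x y, w x y = w y x) {s : V → Prop}
    (hbip : ∀ x y, w x y ≠ 0 → (s x ↔ ¬ s y))
    (hspec : ∀ μ ∈ spectrum ℝ (transition w), μ < 1 → μ ≤ 0)
    {x x' y : V} (hxy : 0 < w x y) (hxy' : 0 < w x' y) (b : V) :
    w x' b * w x y = w x' y * w x b := by
  have hcube := transition_pow_three hw hsymm hbip hspec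
  have hb := transition_row_eq hw hsymm hcube hxy hxy' b
  have hy := transition_row_eq hw hsymm hcube hxy hxy' y
  have hx : 0 < ∑ z, w x z := Finset.sum_pos' (fun z _ => hw x z) ⟨y, Finset.mem_univ y, hxy⟩
  have hx' : 0 < ∑ z, w x' z := Finset.sum_pos' (fun z _ => hw x' z) ⟨y, Finset.mem_univ y, hxy'⟩
  simp only [transition, Matrix.of_apply] at hb hy
  rw [div_eq_div_iff hx.ne' hx'.ne'] at hb hy
  refine mul_right_cancel₀ (mul_pos hx hx').ne' ?_
  linear_combination (w x' b * ∑ z, w x z) * hy - (w x' y * ∑ z, w x z) * hb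

end RandomWalk

namespace CoordinateMixing

open Finset Function

variable {ι V : Type*} [DecidableEq ι]

/-- `b` is a support point of `p` obtained from `a` by changing at most one coordinate, and
agrees with `a` on `S`. -/
def Move (p : (ι → V) → ℝ) (S : Set ι) (a b : ι → V) : Prop :=
  0 < p b ∧ (∀ k ∈ S, b k = a k) ∧ ∃ i v, b = update a i v

theorem Move.mono {p : (ι → V) → ℝ} {S T : Set ι} (h : S ⊆ T) {a b : ι → V}
    (hab : Move p T a b) : Move p S a b :=
  ⟨hab.1, fun k hk => hab.2.1 k (h hk), hab.2.2⟩

theorem Move.exists_notMem {p : (ι → V) → ℝ} {S : Set ι} {a b : ι → V} (hab : Move p S a b) :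
    b = a ∨ ∃ i ∉ S, ∃ v, b = update a i v := by
  obtain ⟨-, hS, i, v, rfl⟩ := hab
  by_cases hi : i ∈ S
  · left
    have := hS i hi
    rw [update_self] at this
    rw [this, update_eq_self]
  · exact Or.inr ⟨i, hi, v, rfl⟩

/-- Every two support points of `p` that agree on `S` are joined by single-coordinate changes that
stay in the support and fix `S`. -/
def GalleryConnected (p : (ι → V) → ℝ) : Prop :=
  ∀ (S : Set ι) (x y : ι → V), 0 < p x → 0 < p y → (∀ k ∈ S, y k = x k) →
    Relation.ReflTransGen (Move p S) x y

/-- Single-coordinate changes inside and outside `A` can be combined, with vanishing `2 × 2`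
minors. -/
def LocallyMixing (p : (ι → V) → ℝ) (A : Finset ι) : Prop :=
  ∀ i ∈ A, ∀ j ∉ A, ∀ (x : ι → V) (a b : V), 0 < p x → 0 < p (update x i a) →
    0 < p (update x j b) →
      p (update (update x i a) j b) * p x = p (update x i a) * p (update x j b)

variable {p : (ι → V) → ℝ} {A : Finset ι}

theorem update_mul_eq (hgal : GalleryConnected p) (hloc : LocallyMixing p A) {x y : ι → V}
    {i : ι} {v : V} (hi : i ∈ A) (hx : 0 < p x) (hx' : 0 < p (update x i v)) (hy : 0 < p y)
    (hxy : ∀ k ∈ A, y k = x k) :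
    0 < p (update y i v) ∧ p (update y i v) * p x = p (update x i v) * p y := by
  have hpath := hgal A x y hx hy hxy
  clear hxy
  induction hpath with
  | refl => exact ⟨hx', rfl⟩
  | @tail y z hpath hstep ih =>
    have hy' : 0 < p y := by
      rcases hpath.cases_tail with rfl | ⟨_, _, h⟩
      · exact hx
      · exact h.1
    obtain ⟨h1, h2⟩ := ih hy'
    rcases hstep.exists_notMem with rfl | ⟨j, hj, b, rfl⟩
    · exact ⟨h1, h2⟩
    · have hji : j ≠ i := fun h => hj (h ▸ hi)
      have h3 := hloc i hi j hj y v b hy' h1 hy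
      rw [update_comm hji.symm] at h3
      refine ⟨pos_of_mul_pos_left (h3 ▸ mul_pos h1 hy) hy'.le, ?_⟩
      refine mul_right_cancel₀ hy'.ne' ?_
      linear_combination p x * h3 + p (update y j b) * h2

theorem piecewise_mul_eq (hgal : GalleryConnected p) (hloc : LocallyMixing p A) {x x' y : ι → V}
    (hx : 0 < p x) (hx' : 0 < p x') (hy : 0 < p y)
    (hxx' : ∀ k ∉ A, x' k = x k) (hxy : ∀ k ∈ A, y k = x k) :
    0 < p (A.piecewise x' y) ∧ p (A.piecewise x' y) * p x = p x' * p y := by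
  have hpath := hgal {k | k ∉ A} x x' hx hx' hxx'
  clear hxx'
  induction hpath with
  | refl =>
    have : A.piecewise x y = y := by
      ext k
      by_cases hk : k ∈ A <;> simp [hk, hxy]
    rw [this]
    exact ⟨hy, mul_comm _ _⟩
  | @tail u z hpath hstep ih =>
    have hu : 0 < p u := by
      rcases hpath.cases_tail with rfl | ⟨_, _, h⟩
      · exact hx
      · exact h.1
    obtain ⟨h1, h2⟩ := ih hu
    rcases hstep.exists_notMem with rfl | ⟨i, hi, v, rfl⟩
    · exact ⟨h1, h2⟩
    · have hi' : i ∈ A := not_not.1 hi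
      have h3 := update_mul_eq hgal hloc hi' hu hx' h1 fun k hk => by simp [hk]
      rw [update_piecewise_of_mem _ _ _ hi'] at h3
      refine ⟨h3.1, mul_right_cancel₀ hu.ne' ?_⟩
      linear_combination p x * h3.2 + p (update u i v) * h2

theorem piecewise_pos (hgal : GalleryConnected p) (hloc : LocallyMixing p A) {x y : ι → V}
    (hx : 0 < p x) (hy : 0 < p y) : 0 < p (A.piecewise x y) := by
  have hpath := hgal ∅ x y hx hy (by simp)
  induction hpath with
  | refl => rwa [piecewise_same]
  | @tail u z hpath hstep ih =>
    have hu : 0 < p u := by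
      rcases hpath.cases_tail with rfl | ⟨_, _, h⟩
      · exact hx
      · exact h.1
    obtain ⟨-, -, j, b, rfl⟩ := hstep
    by_cases hj : j ∈ A
    · have : A.piecewise x (update u j b) = A.piecewise x u :=
        A.piecewise_congr (fun _ _ => rfl) fun k hk =>
          update_of_ne (fun h : k = j => hk (h ▸ hj)) _ _
      rw [this]
      exact ih hu
    · have := (piecewise_mul_eq hgal hloc hu (ih hu) hy (fun k hk => by simp [hk])
        fun k hk => update_of_ne (fun h : k = j => hj (h ▸ hk)) _ _).1
      rwa [piecewise_idem_left] at this

theorem mul_eq_piecewise_mul_of_pos (hgal : GalleryConnected p) (hloc : LocallyMixing p A)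
    {x y : ι → V} (hx : 0 < p x) (hy : 0 < p y) :
    p x * p y = p (A.piecewise x y) * p (A.piecewise y x) := by
  have := (piecewise_mul_eq hgal hloc (piecewise_pos hgal hloc hx hy) hy hx
    (fun k hk => by simp [hk]) fun k hk => by simp [hk]).2
  linarith

/-- `p` is a product of a function of the coordinates in `A` and one of the others. -/
theorem mul_eq_piecewise_mul (hp : ∀ x, 0 ≤ p x) (hgal : GalleryConnected p)
    (hloc : LocallyMixing p A) (x y : ι → V) :
    p x * p y = p (A.piecewise x y) * p (A.piecewise y x) := by
  by_cases h : 0 < p x ∧ 0 < p y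
  · exact mul_eq_piecewise_mul_of_pos hgal hloc h.1 h.2
  by_cases h' : 0 < p (A.piecewise x y) ∧ 0 < p (A.piecewise y x)
  · have := mul_eq_piecewise_mul_of_pos hgal hloc h'.1 h'.2
    simp only [piecewise_idem_left, piecewise_idem_right, piecewise_same] at this
    exact this.symm
  · have hz : ∀ u v : ι → V, ¬ (0 < p u ∧ 0 < p v) → p u * p v = 0 := by
      intro u v huv
      rcases not_and_or.1 huv with h | h
      · rw [le_antisymm (not_lt.1 h) (hp u), zero_mul]
      · rw [le_antisymm (not_lt.1 h) (hp v), mul_zero]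
    rw [hz _ _ h, hz _ _ h']

variable [Fintype ι] [Fintype V] [DecidableEq V]

/-- The `p`-weight of the points that agree with `x` on `J`. -/
noncomputable def marginal (p : (ι → V) → ℝ) (J : Finset ι) (x : ι → V) : ℝ :=
  ∑ z with ∀ k ∈ J, z k = x k, p z

theorem marginal_univ (p : (ι → V) → ℝ) (x : ι → V) : marginal p univ x = p x := by
  have : (univ.filter fun z : ι → V => ∀ k ∈ univ, z k = x k) = {x} := by
    ext z
    simp [funext_iff]
  rw [marginal, this, sum_singleton]

theorem marginal_empty (p : (ι → V) → ℝ) (x : ι → V) : marginal p ∅ x = ∑ z, p z := by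
  simp [marginal]

theorem marginal_congr (p : (ι → V) → ℝ) {J : Finset ι} {x y : ι → V}
    (h : ∀ k ∈ J, x k = y k) : marginal p J x = marginal p J y := by
  unfold marginal
  congr 1
  ext z
  simp only [mem_filter, mem_univ, true_and]
  exact forall₂_congr fun k hk => by rw [h k hk]

theorem le_marginal (hp : ∀ x, 0 ≤ p x) (J : Finset ι) (x : ι → V) : p x ≤ marginal p J x :=
  single_le_sum (f := p) (fun z _ => hp z) (by simp)

theorem marginal_union (hsum : ∑ z, p z = 1)
    (hmul : ∀ x y, p x * p y = p (A.piecewise x y) * p (A.piecewise y x))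
    {J : Finset ι} (hJ : Disjoint A J) (x : ι → V) :
    marginal p (A ∪ J) x = marginal p A x * marginal p J x := by
  have h1 : marginal p (A ∪ J) x = marginal p (A ∪ J) x * ∑ z, p z := by rw [hsum, mul_one]
  rw [h1, marginal, marginal, marginal, sum_mul_sum, sum_mul_sum, ← sum_product', ← sum_product']
  refine sum_bij' (fun q _ => (A.piecewise q.1 q.2, A.piecewise q.2 q.1))
    (fun q _ => (A.piecewise q.1 q.2, A.piecewise q.2 q.1)) ?_ ?_ ?_ ?_ ?_
  · rintro ⟨u, v⟩ h
    simp only [mem_product, mem_filter, mem_univ, true_and, and_true, mem_union] at h ⊢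
    refine ⟨fun k hk => ?_, fun k hk => ?_⟩
    · simp [hk, h k (Or.inl hk)]
    · simp [disjoint_right.1 hJ hk, h k (Or.inr hk)]
  · rintro ⟨u, v⟩ h
    simp only [mem_product, mem_filter, mem_univ, true_and, and_true, mem_union] at h ⊢
    rintro k (hk | hk)
    · simp [hk, h.1 k hk]
    · simp [disjoint_right.1 hJ hk, h.2 k hk]
  · rintro ⟨u, v⟩ -
    simp [piecewise_same]
  · rintro ⟨u, v⟩ -
    simp [piecewise_same]
  · rintro ⟨u, v⟩ -
    exact hmul u v

/-- If `p` splits along every block of a partition, then it is the product of its marginals on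
the blocks. -/
theorem eq_prod_marginal {T : Type*} [Fintype T] [DecidableEq T] (hsum : ∑ z, p z = 1)
    {I : T → Finset ι} (hdisj : ∀ t t', t ≠ t' → Disjoint (I t) (I t'))
    (hcover : univ.sup I = univ)
    (hmul : ∀ t x y, p x * p y = p ((I t).piecewise x y) * p ((I t).piecewise y x))
    (x : ι → V) : p x = ∏ t, marginal p (I t) x := by
  have key : ∀ s : Finset T, marginal p (s.sup I) x = ∏ t ∈ s, marginal p (I t) x := by
    intro s
    induction s using Finset.induction_on with
    | empty => simpa [marginal_empty] using hsum
    | insert t s ht ih =>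
      rw [sup_insert, prod_insert ht, ← ih]
      refine marginal_union hsum (hmul t) ?_ x
      rw [Finset.disjoint_sup_right]
      exact fun t' ht' => hdisj t t' fun h => ht (h ▸ ht')
  rw [← key, hcover, marginal_univ]

end CoordinateMixing

namespace PartiteWeightedComplex

open Finset Function CoordinateMixing WeightedComplex

variable {V : Type*} [Fintype V] [DecidableEq V] {d : ℕ} (K : PartiteWeightedComplex V d)

/-- The facet distribution, as a function of the tuple of vertices ordered by type. -/
noncomputable def weight (z : Fin (d + 1) → V) : ℝ :=
  if ∀ i, K.vtype (z i) = i then K.pi (univ.image z) else 0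

theorem weight_pos_iff {z : Fin (d + 1) → V} :
    0 < K.weight z ↔ (∀ i, K.vtype (z i) = i) ∧ univ.image z ∈ K.facets := by
  unfold weight
  split_ifs with h
  · refine ⟨fun hp => ⟨h, ?_⟩, fun hz => K.pi_pos _ hz.2⟩
    by_contra hz
    exact hp.ne' (K.pi_eq_zero _ hz)
  · simp [h]

theorem weight_eq_pi {z : Fin (d + 1) → V} (hz : ∀ i, K.vtype (z i) = i) :
    K.weight z = K.pi (univ.image z) :=
  if_pos hz

theorem weight_nonneg (z : Fin (d + 1) → V) : 0 ≤ K.weight z := by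
  unfold weight
  split_ifs
  · by_cases hz : univ.image z ∈ K.facets
    · exact (K.pi_pos _ hz).le
    · exact (K.pi_eq_zero _ hz).ge
  · exact le_rfl

variable {K}

theorem index_eq {x z : Fin (d + 1) → V} (hx : ∀ i, K.vtype (x i) = i)
    (hz : ∀ i, K.vtype (z i) = i) {i j : Fin (d + 1)} (h : x i = z j) : i = j := by
  rw [← hx i, h, hz j]

theorem injective_of_typed {z : Fin (d + 1) → V} (hz : ∀ i, K.vtype (z i) = i) : Injective z :=
  fun _ _ h => index_eq hz hz h

theorem apply_mem_image_iff {x z : Fin (d + 1) → V} (hx : ∀ i, K.vtype (x i) = i)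
    (hz : ∀ i, K.vtype (z i) = i) {J : Finset (Fin (d + 1))} {k : Fin (d + 1)} :
    x k ∈ J.image z ↔ k ∈ J ∧ z k = x k := by
  constructor
  · intro h
    obtain ⟨l, hl, hlk⟩ := mem_image.1 h
    obtain rfl := index_eq hz hx hlk
    exact ⟨hl, hlk⟩
  · rintro ⟨hk, h⟩
    exact mem_image.2 ⟨k, hk, h⟩

theorem image_subset_image_univ_iff {x z : Fin (d + 1) → V} (hx : ∀ i, K.vtype (x i) = i)
    (hz : ∀ i, K.vtype (z i) = i) {J : Finset (Fin (d + 1))} :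
    J.image x ⊆ univ.image z ↔ ∀ k ∈ J, z k = x k := by
  simp only [image_subset_iff, apply_mem_image_iff hx hz, mem_univ, true_and]

theorem exists_typed_of_mem_facets {η : Finset V} (hη : η ∈ K.facets) :
    ∃ z : Fin (d + 1) → V, 0 < K.weight z ∧ univ.image z = η := by
  choose z hz using fun i => card_eq_one.1 (K.partite η hη i)
  have hmem : ∀ i, z i ∈ η ∧ K.vtype (z i) = i := fun i =>
    mem_filter.1 (hz i ▸ mem_singleton_self (z i))
  have htyped : ∀ i, K.vtype (z i) = i := fun i => (hmem i).2
  have himage : univ.image z = η := by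
    refine eq_of_subset_of_card_le (image_subset_iff.2 fun i _ => (hmem i).1) ?_
    rw [K.pure η hη, card_image_of_injective _ (injective_of_typed htyped), card_univ,
      Fintype.card_fin]
  exact ⟨z, K.weight_pos_iff.2 ⟨htyped, himage ▸ hη⟩, himage⟩

variable (K) in
theorem sum_facets_filter (Q : Finset V → Prop) [DecidablePred Q] :
    ∑ η ∈ K.facets.filter Q, K.pi η = ∑ z with Q (univ.image z), K.weight z := by
  symm
  have hpos : ∀ z, K.weight z ≠ 0 → 0 < K.weight z := fun z hz =>
    lt_of_le_of_ne (K.weight_nonneg z) hz.symm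
  refine sum_bij_ne_zero (fun z _ _ => univ.image z) ?_ ?_ ?_ ?_
  · intro z hz hz0
    exact mem_filter.2 ⟨(K.weight_pos_iff.1 (hpos z hz0)).2, (mem_filter.1 hz).2⟩
  · intro x _ hx0 z _ hz0 h
    have hx := (K.weight_pos_iff.1 (hpos x hx0)).1
    have hz := (K.weight_pos_iff.1 (hpos z hz0)).1
    ext k
    exact ((image_subset_image_univ_iff hx hz).1 h.subset k (mem_univ k)).symm
  · intro η hη _
    obtain ⟨hη, hQ⟩ := mem_filter.1 hη
    obtain ⟨z, hz, rfl⟩ := exists_typed_of_mem_facets hη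
    exact ⟨z, mem_filter.2 ⟨mem_univ z, hQ⟩, hz.ne', rfl⟩
  · intro z _ hz0
    exact weight_eq_pi K (K.weight_pos_iff.1 (hpos z hz0)).1

variable (K) in
theorem sum_weight : ∑ z, K.weight z = 1 := by
  have := K.sum_facets_filter fun _ => True
  simpa [K.pi_sum_one] using this.symm

theorem faceWeight_image {x : Fin (d + 1) → V} (hx : ∀ i, K.vtype (x i) = i)
    (J : Finset (Fin (d + 1))) :
    K.toWeightedComplex.faceWeight (J.image x) = marginal K.weight J x := by
  rw [faceWeight, sum_facets_filter, marginal, sum_filter, sum_filter]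
  refine sum_congr rfl fun z _ => ?_
  by_cases hz : ∀ i, K.vtype (z i) = i
  · have hiff := image_subset_image_univ_iff hx hz (J := J)
    by_cases h : ∀ k ∈ J, z k = x k
    · rw [if_pos h, if_pos (hiff.2 h)]
    · rw [if_neg h, if_neg (mt hiff.1 h)]
  · simp [weight, hz]

theorem linkWeight_image {x : Fin (d + 1) → V} (hx : ∀ i, K.vtype (x i) = i)
    {i j : Fin (d + 1)} (hij : i ≠ j) :
    K.toWeightedComplex.linkWeight ((univ \ {i, j}).image x) (x i) (x j) =
      K.weight x / K.toWeightedComplex.faceWeight ((univ \ {i, j}).image x) := by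
  have hcond : ¬ (x i = x j ∨ x i ∈ (univ \ {i, j}).image x ∨ x j ∈ (univ \ {i, j}).image x) := by
    simp [apply_mem_image_iff hx hx, (injective_of_typed hx).ne hij]
  have hsub : ∀ η : Finset V, ((univ \ {i, j}).image x ⊆ η ∧ x i ∈ η ∧ x j ∈ η) ↔
      univ.image x ⊆ η := by
    intro η
    simp only [image_subset_iff]
    refine ⟨fun h k _ => ?_, fun h => ⟨fun k _ => h k (mem_univ k), h i (mem_univ i),
      h j (mem_univ j)⟩⟩
    by_cases hki : k = i
    · exact hki ▸ h.2.1
    by_cases hkj : k = j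
    · exact hkj ▸ h.2.2
    · exact h.1 k (by simp [hki, hkj])
  rw [linkWeight, if_neg hcond, ← marginal_univ K.weight x, ← faceWeight_image hx univ]
  simp only [hsub]
  rfl

theorem exists_typed_of_linkWeight_ne_zero {τ : Finset V} {a b : V}
    (h : K.toWeightedComplex.linkWeight τ a b ≠ 0) :
    a ≠ b ∧ a ∉ τ ∧ b ∉ τ ∧ ∃ z, 0 < K.weight z ∧ τ ⊆ univ.image z ∧ (∃ k, z k = a) ∧
      ∃ l, z l = b := by
  unfold linkWeight at h
  split_ifs at h with hcond
  · exact absurd rfl h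
  obtain ⟨hab, ha, hb⟩ : a ≠ b ∧ a ∉ τ ∧ b ∉ τ := by simpa [not_or] using hcond
  refine ⟨hab, ha, hb, ?_⟩
  obtain ⟨η, hη, -⟩ := exists_ne_zero_of_sum_ne_zero fun h0 => h (by rw [h0, zero_div])
  obtain ⟨hη, hτ, haη, hbη⟩ := mem_filter.1 hη
  obtain ⟨z, hz, rfl⟩ := exists_typed_of_mem_facets hη
  exact ⟨z, hz, hτ, by simpa using haη, by simpa using hbη⟩

variable (K) in
theorem linkWeight_nonneg (τ : Finset V) (a b : V) :
    0 ≤ K.toWeightedComplex.linkWeight τ a b := by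
  unfold linkWeight faceWeight
  split_ifs
  · exact le_rfl
  · exact div_nonneg (sum_nonneg fun η hη => (K.pi_pos η (mem_filter.1 hη).1).le)
      (sum_nonneg fun η hη => (K.pi_pos η (mem_filter.1 hη).1).le)

variable (K) in
theorem linkWeight_comm (τ : Finset V) (a b : V) :
    K.toWeightedComplex.linkWeight τ a b = K.toWeightedComplex.linkWeight τ b a := by
  unfold linkWeight
  have h1 : (a = b ∨ a ∈ τ ∨ b ∈ τ) ↔ (b = a ∨ b ∈ τ ∨ a ∈ τ) := by
    rw [eq_comm, or_comm (a := a ∈ τ)]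
  simp only [h1, and_comm (a := a ∈ _)]

theorem isFace_image {x : Fin (d + 1) → V} (hx : 0 < K.weight x) (J : Finset (Fin (d + 1))) :
    K.toWeightedComplex.IsFace (J.image x) :=
  ⟨_, (K.weight_pos_iff.1 hx).2, image_subset_image (subset_univ J)⟩

theorem reflTransGen_move_of_agree (hconn : K.toWeightedComplex.TotallyConnected)
    (S : Finset (Fin (d + 1))) {x y : Fin (d + 1) → V} (hx : 0 < K.weight x)
    (hy : 0 < K.weight y) (hxy : ∀ k ∈ S, y k = x k) :
    Relation.ReflTransGen (Move K.weight S) x y := by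
  induction hn : Sᶜ.card using Nat.strong_induction_on generalizing S x y with
  | _ n ih =>
  have htx := (K.weight_pos_iff.1 hx).1
  rcases le_or_gt n 1 with hn1 | hn2
  · obtain ⟨i, hi⟩ := card_le_one_iff_subset_singleton.1 (hn.trans_le hn1)
    refine .single ⟨hy, hxy, i, y i, ?_⟩
    ext k
    by_cases hk : k = i
    · rw [hk, update_self]
    · rw [update_of_ne hk]
      refine hxy k ?_
      by_contra hkS
      exact hk (mem_singleton.1 (hi (mem_compl.2 hkS)))
  have step : ∀ i ∉ S, ∀ u v : Fin (d + 1) → V, 0 < K.weight u → 0 < K.weight v →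
      (∀ k ∈ insert i S, v k = u k) → Relation.ReflTransGen (Move K.weight S) u v := by
    intro i hi u v hu hv huv
    have hlt : (insert i S)ᶜ.card < n := by
      rw [← hn]
      exact card_lt_card (compl_ssubset_compl.2 (ssubset_insert hi))
    have hsub : (S : Set (Fin (d + 1))) ⊆ (insert i S : Finset (Fin (d + 1))) := by
      exact_mod_cast subset_insert i S
    exact Relation.ReflTransGen.mono (fun a b hab => Move.mono hsub hab) _ _
      (ih _ hlt (insert i S) hu hv huv rfl)
  have hty := (K.weight_pos_iff.1 hy).1
  obtain ⟨i, hi⟩ : ∃ i, i ∈ Sᶜ := card_pos.1 (by omega)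
  have hiS : i ∉ S := mem_compl.1 hi
  have hτ : S.image y = S.image x := image_congr fun k hk => hxy k hk
  have hcard : (S.image x).card + 2 ≤ d + 1 := by
    rw [card_image_of_injective _ (injective_of_typed htx)]
    have := card_add_card_compl S
    rw [Fintype.card_fin] at this
    omega
  have hreach := hconn (S.image x) (isFace_image hx S) hcard (x i) (y i)
    (by simp [apply_mem_image_iff htx htx, hiS]) (by rw [← image_insert]; exact isFace_image hx _)
    (by simp [apply_mem_image_iff hty htx, hiS])
    (by rw [← hτ, ← image_insert]; exact isFace_image hy _)
  have key : ∀ c, Relation.ReflTransGen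
      (fun a b => 0 < K.toWeightedComplex.linkWeight (S.image x) a b) (x i) c →
      ∀ z, 0 < K.weight z → (∀ k ∈ S, z k = x k) → (∃ k, z k = c) →
        Relation.ReflTransGen (Move K.weight S) x z := by
    intro c hc
    induction hc with
    | refl =>
      rintro z hz hzx ⟨k, hk⟩
      obtain rfl := index_eq (K.weight_pos_iff.1 hz).1 htx hk
      refine step k hiS x z hx hz fun l hl => ?_
      rcases mem_insert.1 hl with rfl | hl
      exacts [hk, hzx l hl]
    | tail _ hstep ih' =>
      rintro z hz hzx ⟨k, rfl⟩
      obtain ⟨-, -, hb, u, hu, hτu, ha, l, hl⟩ := exists_typed_of_linkWeight_ne_zero hstep.ne'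
      have htu := (K.weight_pos_iff.1 hu).1
      have htz := (K.weight_pos_iff.1 hz).1
      obtain rfl := index_eq htu htz hl
      have hux := (image_subset_image_univ_iff htx htu).1 hτu
      refine (ih' u hu hux ha).trans (step l (fun hlS => hb ?_) u z hu hz fun q hq => ?_)
      · rw [hzx l hlS]
        exact mem_image_of_mem x hlS
      · rcases mem_insert.1 hq with rfl | hq
        · exact hl.symm
        · rw [hzx q hq, hux q hq]
  exact key (y i) hreach y hy hxy ⟨i, rfl⟩

theorem galleryConnected_weight (hconn : K.toWeightedComplex.TotallyConnected) :
    GalleryConnected K.weight := by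
  classical
  intro S x y hx hy hxy
  have := reflTransGen_move_of_agree hconn S.toFinset hx hy (by simpa using hxy)
  rwa [Set.coe_toFinset] at this

theorem le_zero_of_mem_spectrum {i j : Fin (d + 1)} (heps : ¬ 0 < K.eps i j) {τ : Finset V}
    (hτ : K.toWeightedComplex.IsFace τ) (htype : τ.image K.vtype = univ \ {i, j}) {μ : ℝ}
    (hμ : μ ∈ spectrum ℝ (K.toWeightedComplex.walkMatrix τ)) (hμ1 : μ < 1) : μ ≤ 0 := by
  have hfin : {r : ℝ | ∃ τ : Finset V, K.toWeightedComplex.IsFace τ ∧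
      τ.image K.vtype = univ \ {i, j} ∧
      r = lambda2 (K.toWeightedComplex.walkMatrix τ)}.Finite := by
    refine (Set.finite_range fun τ => lambda2 (K.toWeightedComplex.walkMatrix τ)).subset ?_
    rintro r ⟨τ, -, -, rfl⟩
    exact ⟨τ, rfl⟩
  calc μ ≤ lambda2 (K.toWeightedComplex.walkMatrix τ) :=
        le_csSup ((Matrix.finite_real_spectrum.subset fun _ h => h.2).bddAbove) ⟨hμ1, hμ⟩
    _ ≤ K.eps i j := le_csSup hfin.bddAbove ⟨τ, hτ, htype, rfl⟩
    _ ≤ 0 := not_lt.1 heps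

theorem locallyMixing_weight {A : Finset (Fin (d + 1))}
    (hA : ∀ i ∈ A, ∀ j ∉ A, ¬ 0 < K.eps i j) : LocallyMixing K.weight A := by
  intro i hi j hj x a b hx hxa hxb
  have hij : i ≠ j := fun h => hj (h ▸ hi)
  have htx := (K.weight_pos_iff.1 hx).1
  have hta := (K.weight_pos_iff.1 hxa).1
  have htb := (K.weight_pos_iff.1 hxb).1
  have htab : ∀ k, K.vtype (update (update x i a) j b k) = k := by
    intro k
    by_cases hk : k = j
    · subst hk
      simpa using htb k
    · simpa [update_of_ne hk] using hta k
  set τ := (univ \ {i, j}).image x with hτdef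
  have hτ : K.toWeightedComplex.IsFace τ := isFace_image hx _
  have htype : τ.image K.vtype = univ \ {i, j} := by
    rw [hτdef, image_image]
    exact (image_congr fun k _ => htx k).trans image_id
  have hfw : 0 < K.toWeightedComplex.faceWeight τ := by
    rw [hτdef, faceWeight_image htx]
    exact hx.trans_le (le_marginal K.weight_nonneg _ _)
  have hlink : ∀ z : Fin (d + 1) → V, (∀ k, K.vtype (z k) = k) →
      (∀ k, k ≠ i → k ≠ j → z k = x k) →
      K.toWeightedComplex.linkWeight τ (z i) (z j) =
        K.weight z / K.toWeightedComplex.faceWeight τ := by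
    intro z hz hzx
    have : τ = (univ \ {i, j}).image z := image_congr fun k hk => by
      simp only [coe_sdiff, coe_univ, Set.mem_sdiff, Set.mem_univ, true_and, coe_insert,
        coe_singleton, Set.mem_insert_iff, Set.mem_singleton_iff, not_or] at hk
      exact (hzx k hk.1 hk.2).symm
    rw [this]
    exact linkWeight_image hz hij
  have hbip : ∀ u v, K.toWeightedComplex.linkWeight τ u v ≠ 0 →
      (K.vtype u = i ↔ ¬ K.vtype v = i) := by
    intro u v huv
    obtain ⟨hne, hu, hv, z, hz, hτz, ⟨k, rfl⟩, l, rfl⟩ := exists_typed_of_linkWeight_ne_zero huv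
    have htz := (K.weight_pos_iff.1 hz).1
    have hzx := (image_subset_image_univ_iff htx htz).1 hτz
    have hmem : ∀ q, z q ∉ τ → q = i ∨ q = j := by
      intro q hq
      by_contra h
      have hq' : q ∈ univ \ {i, j} := by simpa using h
      exact hq (hzx q hq' ▸ mem_image_of_mem x hq')
    have hkl : k ≠ l := fun h => hne (h ▸ rfl)
    rw [htz k, htz l]
    have hk := hmem k hu
    have hl := hmem l hv
    clear_value τ
    clear hmem hzx hlink
    grind
  have h00 := hlink x htx fun _ _ _ => rfl
  have h10 := hlink _ hta fun k hk _ => update_of_ne hk _ _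
  have h01 := hlink _ htb fun k _ hk => update_of_ne hk _ _
  have h11 := hlink _ htab fun k hk hk' => by rw [update_of_ne hk', update_of_ne hk]
  simp only [update_self, update_of_ne hij, update_of_ne hij.symm] at h10 h01 h11
  have key := RandomWalk.weight_mul_weight_comm (K.linkWeight_nonneg τ) (K.linkWeight_comm τ)
    hbip (fun μ hμ hμ1 => le_zero_of_mem_spectrum (hA i hi j hj) hτ htype hμ hμ1)
    (h00 ▸ div_pos hx hfw) (h10 ▸ div_pos hxa hfw) b
  rw [h00, h10, h01, h11] at key
  field_simp at key
  exact key

theorem exists_typed_of_isFace {σ : Finset V} (hσ : K.toWeightedComplex.IsFace σ)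
    {J : Finset (Fin (d + 1))} (htype : σ.image K.vtype = J) :
    ∃ s, 0 < K.weight s ∧ σ = J.image s := by
  obtain ⟨η, hη, hση⟩ := hσ
  obtain ⟨s, hs, rfl⟩ := exists_typed_of_mem_facets hη
  have hts := (K.weight_pos_iff.1 hs).1
  refine ⟨s, hs, ?_⟩
  have hval : ∀ v ∈ σ, s (K.vtype v) = v := by
    intro v hv
    obtain ⟨k, -, rfl⟩ := mem_image.1 (hση hv)
    rw [hts k]
  rw [← htype, image_image]
  exact (image_id.symm.trans (image_congr fun v hv => (hval v hv).symm))

theorem mem_linkFacets_image_iff {s : Fin (d + 1) → V} (hs : ∀ k, K.vtype (s k) = k)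
    {I : Finset (Fin (d + 1))} {g : Finset V} :
    g ∈ K.toWeightedComplex.linkFacets ((univ \ I).image s) ↔
      ∃ x, 0 < K.weight x ∧ (∀ k ∉ I, x k = s k) ∧ g = I.image x := by
  have hdiff : ∀ x : Fin (d + 1) → V, (∀ k, K.vtype (x k) = k) → (∀ k ∉ I, x k = s k) →
      univ.image x \ (univ \ I).image s = I.image x := by
    intro x hx hxs
    have : (univ \ I).image s = (univ \ I).image x :=
      image_congr fun k hk => (hxs k (by simpa using hk)).symm
    rw [this, ← image_sdiff _ _ (injective_of_typed hx), sdiff_sdiff_right_self, inf_eq_inter,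
      univ_inter]
  simp only [linkFacets, mem_image, mem_filter]
  constructor
  · rintro ⟨η, ⟨hη, hsub⟩, rfl⟩
    obtain ⟨x, hx, rfl⟩ := exists_typed_of_mem_facets hη
    have htx := (K.weight_pos_iff.1 hx).1
    have hxs : ∀ k ∉ I, x k = s k := fun k hk =>
      (image_subset_image_univ_iff hs htx).1 hsub k (by simpa using hk)
    exact ⟨x, hx, hxs, hdiff x htx hxs⟩
  · rintro ⟨x, hx, hxs, rfl⟩
    obtain ⟨htx, hfx⟩ := K.weight_pos_iff.1 hx
    exact ⟨univ.image x, ⟨hfx, (image_subset_image_univ_iff hs htx).2 fun k hk =>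
      hxs k (by simpa using hk)⟩, hdiff x htx hxs⟩

theorem linkPi_image {s x : Fin (d + 1) → V} (hx : 0 < K.weight x)
    {I : Finset (Fin (d + 1))} (hxs : ∀ k ∉ I, x k = s k)
    (hmul : ∀ x y, K.weight x * K.weight y =
      K.weight (I.piecewise x y) * K.weight (I.piecewise y x)) :
    K.toWeightedComplex.linkPi ((univ \ I).image s) (I.image x) = marginal K.weight I x := by
  have htx := (K.weight_pos_iff.1 hx).1
  have hs : (univ \ I).image s = (univ \ I).image x :=
    image_congr fun k hk => (hxs k (by simpa using hk)).symm
  have hunion := marginal_union K.sum_weight hmul (disjoint_sdiff (s := I) (t := univ)) x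
  rw [union_sdiff_of_subset (subset_univ I), marginal_univ] at hunion
  rw [linkPi, hs, ← image_union, union_sdiff_of_subset (subset_univ I), ← K.weight_eq_pi htx,
    faceWeight_image htx, hunion]
  exact mul_div_cancel_right₀ _ (hx.trans_le (le_marginal K.weight_nonneg _ _)).ne'

end PartiteWeightedComplex

open WeightedComplex PartiteWeightedComplex in
/-- If the types of a totally connected `(d+1)`-partite complex are partitioned into sets
`I_1, …, I_m`, each a union of connected components of the graph `G_{(X,π)}`, then `(X,π)`
decomposes as the product of the links `(X_{σ_{-t}}, π_{σ_{-t}})`, for any faces `σ_{-t}` of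
types `[d] ∖ I_t`: the facets of `X` are exactly the unions of facets of the links, and `π` is
the product of the link distributions. -/
theorem product_decomposition_along_components
    {V : Type*} [Fintype V] [DecidableEq V] {d : ℕ}
    (K : PartiteWeightedComplex V d)
    (hconn : K.toWeightedComplex.TotallyConnected)
    (m : ℕ) (I : Fin m → Finset (Fin (d + 1)))
    (hne : ∀ t, (I t).Nonempty)
    (hdisj : ∀ t t', t ≠ t' → Disjoint (I t) (I t'))
    (hcover : Finset.univ.sup I = Finset.univ)
    (hclosed : ∀ t, ∀ i ∈ I t, ∀ j : Fin (d + 1),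
      Relation.ReflTransGen (fun a b => a ≠ b ∧ 0 < K.eps a b) i j → j ∈ I t)
    (σs : Fin m → Finset V)
    (hσ : ∀ t, K.toWeightedComplex.IsFace (σs t) ∧
      (σs t).image K.vtype = Finset.univ \ I t) :
    (∀ η : Finset V, η ∈ K.facets ↔
      ∃ g : Fin m → Finset V, (∀ t, g t ∈ K.toWeightedComplex.linkFacets (σs t)) ∧
        η = Finset.univ.sup g) ∧
    (∀ g : Fin m → Finset V, (∀ t, g t ∈ K.toWeightedComplex.linkFacets (σs t)) →
      K.pi (Finset.univ.sup g) = ∏ t, K.toWeightedComplex.linkPi (σs t) (g t)) := by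
  classical
  have hgal := galleryConnected_weight hconn
  have hloc : ∀ t, CoordinateMixing.LocallyMixing K.weight (I t) := fun t =>
    locallyMixing_weight fun i hi j hj heps =>
      hj (hclosed t i hi j (.single ⟨fun h => hj (h ▸ hi), heps⟩))
  have hmul := fun t =>
    CoordinateMixing.mul_eq_piecewise_mul K.weight_nonneg hgal (hloc t)
  have hprod := CoordinateMixing.eq_prod_marginal K.sum_weight hdisj hcover hmul
  choose s hs hσs using fun t => exists_typed_of_isFace (hσ t).1 (hσ t).2
  have hts : ∀ t k, K.vtype (s t k) = k := fun t => (K.weight_pos_iff.1 (hs t)).1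
  have hblock : ∀ k, ∃ t, k ∈ I t := fun k => by
    have : k ∈ Finset.univ.sup I := hcover ▸ Finset.mem_univ k
    simpa [Finset.mem_sup] using this
  have hsup : ∀ y : Fin (d + 1) → V,
      Finset.univ.sup (fun t => (I t).image y) = Finset.univ.image y := by
    intro y
    ext v
    simp only [Finset.mem_sup, Finset.mem_univ, true_and, Finset.mem_image]
    constructor
    · rintro ⟨t, k, -, h⟩
      exact ⟨k, h⟩
    · rintro ⟨k, h⟩
      obtain ⟨t, ht⟩ := hblock k
      exact ⟨t, k, ht, h⟩
  have hglue : ∀ g : Fin m → Finset V,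
      (∀ t, g t ∈ K.toWeightedComplex.linkFacets (σs t)) →
      ∃ y, 0 < K.weight y ∧ Finset.univ.sup g = Finset.univ.image y ∧
        K.weight y = ∏ t, K.toWeightedComplex.linkPi (σs t) (g t) := by
    intro g hg
    have hg' : ∀ t, ∃ x, 0 < K.weight x ∧ (∀ k ∉ I t, x k = s t k) ∧ g t = (I t).image x :=
      fun t => (mem_linkFacets_image_iff (hts t)).1 (hσs t ▸ hg t)
    choose x hx hxs hgx using hg'
    choose b hb using hblock
    have hyx : ∀ t, ∀ k ∈ I t, x (b k) k = x t k := fun t k hk => by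
      by_cases hbt : b k = t
      · rw [hbt]
      · exact absurd hk (Finset.disjoint_left.1 (hdisj _ _ hbt) (hb k))
    have hgy : g = fun t => (I t).image fun k => x (b k) k := funext fun t => by
      rw [hgx t]
      exact Finset.image_congr fun k hk => (hyx t k hk).symm
    have hmarg : ∀ t, CoordinateMixing.marginal K.weight (I t) (fun k => x (b k) k) =
        CoordinateMixing.marginal K.weight (I t) (x t) := fun t =>
      CoordinateMixing.marginal_congr _ (hyx t)
    refine ⟨fun k => x (b k) k, ?_, ?_, ?_⟩
    · rw [hprod]
      refine Finset.prod_pos fun t _ => ?_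
      rw [hmarg t]
      exact (hx t).trans_le (CoordinateMixing.le_marginal K.weight_nonneg _ _)
    · rw [hgy, hsup]
    · rw [hprod]
      refine Finset.prod_congr rfl fun t _ => ?_
      rw [hmarg t, hσs t, hgx t, linkPi_image (hx t) (hxs t) (hmul t)]
  refine ⟨fun η => ⟨fun hη => ?_, ?_⟩, fun g hg => ?_⟩
  · obtain ⟨x, hx, rfl⟩ := exists_typed_of_mem_facets hη
    refine ⟨fun t => (I t).image x, fun t => ?_, (hsup x).symm⟩
    rw [hσs t, mem_linkFacets_image_iff (hts t)]
    exact ⟨(I t).piecewise x (s t),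
      CoordinateMixing.piecewise_pos hgal (hloc t) hx (hs t),
      fun k hk => by simp [hk], Finset.image_congr fun k hk => by
        simp [Finset.mem_coe.1 hk]⟩
  · rintro ⟨g, hg, rfl⟩
    obtain ⟨y, hy, hgy, -⟩ := hglue g hg
    exact hgy ▸ (K.weight_pos_iff.1 hy).2
  · obtain ⟨y, hy, hgy, hw⟩ := hglue g hg
    rw [hgy, ← hw, K.weight_eq_pi (K.weight_pos_iff.1 hy).1]
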